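/- arXiv:2510.20588 — 6 statements merged into one kernel-verified Lean document; each statement's English description precedes it below -/
import Mathlib

section
/- Let (V, d) be a finite metric space with |V| even, and let 𝒞 be a partition of V into components. Let 𝒞_odd ⊆ 𝒞 be the set of components containing an odd number of vertices, and let W_OPT be the minimum total weight ∑ d(p_i, q_i) of a perfect matching of V. For each C ∈ 𝒞_odd define r_C = min_{C' ∈ 𝒞_odd, C' ≠ C} D(C, C'), where D is the compressed distance. Then ∑_{C ∈ 𝒞_odd} r_C ≤ 2 · W_OPT. -/
/-- The distance between two components: `d(C, C') = min_{u ∈ C, v ∈ C'} d(u, v)`. -/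
noncomputable def compDist {V : Type*} [MetricSpace V] (C C' : Finset V) : ℝ :=
  sInf {r : ℝ | ∃ u ∈ C, ∃ v ∈ C', r = dist u v}

/-- The weight of a path of components: the sum of the component distances between
consecutive components along the path. -/
noncomputable def pathWeight {V : Type*} [MetricSpace V] : List (Finset V) → ℝ
  | [] => 0
  | [_] => 0
  | C :: C' :: rest => compDist C C' + pathWeight (C' :: rest)

/-- The compressed distance `D(A, B)`: the minimum over all sequences of pairwise
distinct components `A = C₁, C₂, …, C_k = B` (all belonging to the decomposition `𝒞`),
with all intermediate components `C₂, …, C_{k-1}` even, of `∑ d(C_i, C_{i+1})`. -/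
noncomputable def comprDist {V : Type*} [MetricSpace V] (𝒞 : Finset (Finset V))
    (A B : Finset V) : ℝ :=
  sInf {w : ℝ | ∃ L : List (Finset V), L ≠ [] ∧ L.head? = some A ∧ L.getLast? = some B ∧
    L.Nodup ∧ (∀ C ∈ L, C ∈ 𝒞) ∧ (∀ C ∈ (L.drop 1).dropLast, Even C.card) ∧
    w = pathWeight L}

section PathWeight

variable {V : Type*} [MetricSpace V]

theorem compDist_nonneg (C C' : Finset V) : 0 ≤ compDist C C' := by
  apply Real.sInf_nonneg
  rintro r ⟨u, -, v, -, rfl⟩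
  exact dist_nonneg

theorem compDist_le_dist {C C' : Finset V} {u v : V} (hu : u ∈ C) (hv : v ∈ C') :
    compDist C C' ≤ dist u v := by
  apply csInf_le
  · refine ⟨0, ?_⟩
    rintro r ⟨u, -, v, -, rfl⟩
    exact dist_nonneg
  · exact ⟨u, hu, v, hv, rfl⟩

theorem pathWeight_nonneg (L : List (Finset V)) : 0 ≤ pathWeight L := by
  induction L with
  | nil => simp [pathWeight]
  | cons a L ih =>
    cases L with
    | nil => simp [pathWeight]
    | cons b L =>
      simp only [pathWeight]
      exact add_nonneg (compDist_nonneg a b) ih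

theorem pathWeight_le_cons (a : Finset V) (L : List (Finset V)) :
    pathWeight L ≤ pathWeight (a :: L) := by
  cases L with
  | nil => simp [pathWeight]
  | cons b L =>
    simp only [pathWeight]
    exact le_add_of_nonneg_left (compDist_nonneg a b)

theorem pathWeight_le_append (s t : List (Finset V)) : pathWeight t ≤ pathWeight (s ++ t) := by
  induction s with
  | nil => simp
  | cons a s ih => exact ih.trans (pathWeight_le_cons a (s ++ t))

/-- Every walk of components can be shortcut to a path that is not heavier. -/
theorem exists_nodup_pathWeight_le (n : ℕ) (w : ℕ → Finset V) :
    ∃ L : List (Finset V), L.head? = some (w 0) ∧ L.getLast? = some (w n) ∧ L.Nodup ∧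
      (∀ C ∈ L, ∃ i ≤ n, C = w i) ∧
      pathWeight L ≤ ∑ i ∈ Finset.range n, compDist (w i) (w (i + 1)) := by
  induction n generalizing w with
  | zero => exact ⟨[w 0], by simp [pathWeight]⟩
  | succ n ih =>
    obtain ⟨L, hhead, hlast, hnodup, hmem, hweight⟩ := ih fun i => w (i + 1)
    rw [Finset.sum_range_succ']
    by_cases h : w 0 ∈ L
    · obtain ⟨s, t, rfl⟩ := List.append_of_mem h
      refine ⟨w 0 :: t, by simp, by simpa using hlast, (List.nodup_append.1 hnodup).2.1, ?_, ?_⟩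
      · intro C hC
        obtain ⟨i, hi, rfl⟩ := hmem C (List.mem_append_right s hC)
        exact ⟨i + 1, by omega, rfl⟩
      · have := pathWeight_le_append s (w 0 :: t)
        have := compDist_nonneg (w 0) (w (0 + 1))
        linarith
    · obtain ⟨b, t, rfl⟩ : ∃ b t, L = b :: t := by
        cases L with
        | nil => simp at hhead
        | cons b t => exact ⟨b, t, rfl⟩
      obtain rfl : b = w (0 + 1) := by simpa using hhead
      refine ⟨w 0 :: w (0 + 1) :: t, by simp, by simpa using hlast,
        List.nodup_cons.2 ⟨h, hnodup⟩, ?_, ?_⟩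
      · intro C hC
        rcases List.mem_cons.1 hC with rfl | hC
        · exact ⟨0, by omega, rfl⟩
        · obtain ⟨i, hi, rfl⟩ := hmem C hC
          exact ⟨i + 1, by omega, rfl⟩
      · simp only [pathWeight]
        linarith

theorem comprDist_nonneg (𝒞 : Finset (Finset V)) (A B : Finset V) : 0 ≤ comprDist 𝒞 A B := by
  apply Real.sInf_nonneg
  rintro r ⟨L, -, -, -, -, -, -, rfl⟩
  exact pathWeight_nonneg L

theorem comprDist_le_pathWeight {𝒞 : Finset (Finset V)} {A B : Finset V} {L : List (Finset V)}
    (hhead : L.head? = some A) (hlast : L.getLast? = some B) (hnodup : L.Nodup)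
    (hmem : ∀ C ∈ L, C ∈ 𝒞) (heven : ∀ C ∈ (L.drop 1).dropLast, Even C.card) :
    comprDist 𝒞 A B ≤ pathWeight L := by
  apply csInf_le
  · refine ⟨0, ?_⟩
    rintro r ⟨L, -, -, -, -, -, -, rfl⟩
    exact pathWeight_nonneg L
  · refine ⟨L, ?_, hhead, hlast, hnodup, hmem, heven, rfl⟩
    rintro rfl
    simp at hhead

theorem List.Nodup.ne_of_mem_dropLast_drop_one {α : Type*} {L : List α} (h : L.Nodup) {a b x : α}
    (hhead : L.head? = some a) (hlast : L.getLast? = some b) (hx : x ∈ (L.drop 1).dropLast) :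
    x ∈ L ∧ x ≠ a ∧ x ≠ b := by
  cases L with
  | nil => simp at hhead
  | cons c t =>
    obtain rfl : c = a := by simpa using hhead
    rcases List.eq_nil_or_concat t with rfl | ⟨s, d, rfl⟩
    · simp at hx
    · simp only [List.concat_eq_append] at *
      have hd : d = b := by
        rw [← List.cons_append, List.getLast?_append] at hlast
        simpa using hlast
      subst hd
      simp only [List.drop_succ_cons, List.drop_zero, List.dropLast_concat] at hx
      simp only [List.nodup_cons, List.nodup_append, List.mem_append, List.mem_singleton] at h
      refine ⟨by simp [hx], ?_, ?_⟩
      · rintro rfl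
        exact h.1 (Or.inl hx)
      · rintro rfl
        exact h.2.2.2 x hx x rfl rfl

/-- A walk whose inner components are even or equal to an endpoint bounds the compressed
distance of its endpoints. -/
theorem comprDist_le_sum_compDist {𝒞 : Finset (Finset V)} (n : ℕ) (w : ℕ → Finset V)
    (hmem : ∀ i, w i ∈ 𝒞) (heven : ∀ i < n, Even (w i).card ∨ w i = w 0) :
    comprDist 𝒞 (w 0) (w n) ≤ ∑ i ∈ Finset.range n, compDist (w i) (w (i + 1)) := by
  obtain ⟨L, hhead, hlast, hnodup, hL, hweight⟩ := exists_nodup_pathWeight_le n w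
  refine (comprDist_le_pathWeight hhead hlast hnodup ?_ ?_).trans hweight
  · intro C hC
    obtain ⟨i, -, rfl⟩ := hL C hC
    exact hmem i
  · intro C hC
    obtain ⟨hCL, h0, hn⟩ := hnodup.ne_of_mem_dropLast_drop_one hhead hlast hC
    obtain ⟨i, hi, rfl⟩ := hL C hCL
    have hin : i ≠ n := by
      rintro rfl
      exact hn rfl
    exact (heven i (by omega)).resolve_right h0

end PathWeight

/-- A finite set carries an involution with no fixed point or exactly one fixed point,
according to the parity of its cardinality. -/
theorem Finset.exists_involutive_fixedPoint {V : Type*} [DecidableEq V] (S : Finset V) :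
    ∃ g : V → V, Function.Involutive g ∧ (∀ v ∉ S, g v = v) ∧
      (Even S.card → ∀ v ∈ S, g v ≠ v) ∧
      (Odd S.card → ∃ c ∈ S, ∀ v ∈ S, g v = v ↔ v = c) := by
  induction hn : S.card using Nat.strong_induction_on generalizing S with
  | _ n ih =>
    subst hn
    rcases Nat.lt_or_ge 1 S.card with h | h
    · obtain ⟨a, ha, b, hb, hab⟩ := Finset.one_lt_card.1 h
      have hcard : ((S.erase a).erase b).card + 2 = S.card := by
        rw [Finset.card_erase_of_mem (by simp [hb, hab.symm]), Finset.card_erase_of_mem ha]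
        omega
      obtain ⟨g, hg, hfix, heven, hodd⟩ := ih _ (by omega) ((S.erase a).erase b) rfl
      have hga : g a = a := hfix a (by simp)
      have hgb : g b = b := hfix b (by simp)
      have hinv : ∀ v, g (g v) = v := hg
      refine ⟨fun v => if v = a then b else if v = b then a else g v, ?_, ?_, ?_, ?_⟩
      · intro v
        grind
      · intro v hv
        grind
      · intro hS v hv
        have := heven (by grind) v
        grind
      · intro hS
        obtain ⟨c, hc, hcv⟩ := hodd (by grind)
        refine ⟨c, by grind, fun v hv => ?_⟩
        have := hcv v
        grind
    · refine ⟨id, fun _ => rfl, fun _ _ => rfl, ?_, ?_⟩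
      · intro hS v hv
        have := Finset.card_pos.2 ⟨v, hv⟩
        grind
      · intro hS
        obtain ⟨c, rfl⟩ := Finset.card_eq_one.1 (show S.card = 1 by grind)
        exact ⟨c, by simp⟩

/-- If `f` and `g` are involutions and `f` has no fixed point, then the orbit under `g ∘ f` of a
fixed point of `g` contains another fixed point of `g`. -/
theorem Function.Involutive.exists_iterate_comp_fixedPoint {V : Type*} [Finite V] {f g : V → V}
    (hf : Function.Involutive f) (hfne : ∀ v, f v ≠ v) (hg : Function.Involutive g) {c : V}
    (hc : g c = c) : ∃ k : ℕ, g ((g ∘ f)^[k] c) = (g ∘ f)^[k] c ∧ (g ∘ f)^[k] c ≠ c := by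
  have hinj : Function.Injective (g ∘ f) := hg.injective.comp hf.injective
  have hper : c ∈ Function.periodicPts (g ∘ f) := by
    simp [hinj.mem_periodicPts]
  set m := Function.minimalPeriod (g ∘ f) c with hm
  have hmpos : 0 < m := Function.minimalPeriod_pos_of_mem_periodicPts hper
  have hmc : (g ∘ f)^[m] c = c := Function.iterate_minimalPeriod
  have hback : ∀ k, (g ∘ f)^[k] (g ((g ∘ f)^[k] c)) = c := by
    intro k
    induction k with
    | zero => simpa using hc
    | succ k ih =>
      rw [Function.iterate_succ_apply' (g ∘ f) k c, Function.iterate_succ_apply]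
      simp only [Function.comp_apply, hg _, hf _]
      exact ih
  have hrefl : ∀ j k, j + k = m → g ((g ∘ f)^[k] c) = (g ∘ f)^[j] c := by
    intro j k hjk
    apply hinj.iterate k
    rw [hback, ← Function.iterate_add_apply, add_comm k j, hjk, hmc]
  rcases Nat.even_or_odd' m with ⟨k, hk | hk⟩
  · refine ⟨k, hrefl k k (by omega), fun h => ?_⟩
    have := Function.IsPeriodicPt.minimalPeriod_le (show 0 < k by omega) h
    omega
  · have h := hrefl k (k + 1) (by omega)
    rw [Function.iterate_succ_apply'] at h
    simp only [Function.comp_apply, hg _] at h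
    exact absurd h (hfne _)

/-- Orbit segments of an injective map that start at distinct points, and stop as soon as they
enter a set containing the other starting points, are disjoint. -/
theorem Finset.sum_iterate_le_sum {ι V : Type*} [Fintype V] {s : V → V}
    (hs : Function.Injective s) {F : V → ℝ} (hF : ∀ v, 0 ≤ F v) (I : Finset ι) (c : ι → V)
    (n : ι → ℕ) (P : ι → V → Prop) (hn : ∀ i ∈ I, P i (s^[n i] (c i)))
    (hlt : ∀ i ∈ I, ∀ k < n i, ¬ P i (s^[k] (c i)))
    (hP : ∀ i ∈ I, ∀ j ∈ I, i ≠ j → P i (c j)) :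
    ∑ i ∈ I, ∑ k ∈ Finset.range (n i), F (s^[k] (c i)) ≤ ∑ v, F v := by
  classical
  have key : ∀ i ∈ I, ∀ j ∈ I, ∀ k < n i, ∀ l < n j, k ≤ l →
      s^[k] (c i) = s^[l] (c j) → i = j ∧ k = l := by
    intro i hi j hj k hk l hl hkl h
    obtain ⟨d, rfl⟩ := Nat.exists_eq_add_of_le hkl
    rw [Function.iterate_add_apply] at h
    have h := hs.iterate k h
    by_cases hij : i = j
    · subst hij
      refine ⟨rfl, ?_⟩
      by_contra hd
      apply hlt i hi (n i - d) (by omega)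
      have := hn i hi
      rwa [show n i = (n i - d) + d by omega, Function.iterate_add_apply, ← h] at this
    · exact absurd (h ▸ hP j hj i hi (Ne.symm hij)) (hlt j hj d (by omega))
  rw [Finset.sum_sigma', ← Finset.sum_image (s := I.sigma fun i => Finset.range (n i))
    (g := fun x => s^[x.2] (c x.1)) (f := F)]
  · exact Finset.sum_le_univ_sum_of_nonneg hF
  · rintro ⟨i, k⟩ hik ⟨j, l⟩ hjl h
    simp only [Finset.coe_sigma, Set.mem_sigma_iff, Finset.mem_coe, Finset.mem_range] at hik hjl
    rcases le_total k l with hkl | hkl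
    · obtain ⟨rfl, rfl⟩ := key i hik.1 j hjl.1 k hik.2 l hjl.2 hkl h
      rfl
    · obtain ⟨rfl, rfl⟩ := key j hjl.1 i hik.1 l hjl.2 k hik.2 hkl h.symm
      rfl

/-- Let `V` be a finite metric space of even cardinality, `𝒞` a component
decomposition of `V`, `𝒞_odd` the odd components, and `W_OPT` the weight of the
minimum-cost perfect matching of `V` (matchings given as fixed-point-free
involutions).  With `r_C = min_{C' ∈ 𝒞_odd, C' ≠ C} D(C, C')` (`D` the compressed
distance), we have `∑_{C ∈ 𝒞_odd} r_C ≤ 2 · W_OPT`. -/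
theorem sum_comprDist_le_two_OPT {V : Type*} [Fintype V] [DecidableEq V] [MetricSpace V]
    (hV : Even (Fintype.card V))
    (𝒞 : Finset (Finset V))
    (hne : ∀ C ∈ 𝒞, C.Nonempty)
    (hpart : ∀ v : V, ∃! C, C ∈ 𝒞 ∧ v ∈ C) :
    ∑ C ∈ 𝒞.filter (fun C => Odd C.card),
        sInf {x : ℝ | ∃ C' ∈ 𝒞, Odd C'.card ∧ C' ≠ C ∧ x = comprDist 𝒞 C C'}
      ≤ 2 * sInf {w : ℝ | ∃ f : V → V, Function.Involutive f ∧ (∀ v, f v ≠ v) ∧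
          w = (1/2) * ∑ v, dist v (f v)} := by
  have hmatching : {w : ℝ | ∃ f : V → V, Function.Involutive f ∧ (∀ v, f v ≠ v) ∧
      w = (1/2) * ∑ v, dist v (f v)}.Nonempty := by
    obtain ⟨f, hf, -, hfne, -⟩ := (Finset.univ : Finset V).exists_involutive_fixedPoint
    exact ⟨_, f, hf, fun v => hfne hV v (Finset.mem_univ v), rfl⟩
  rw [← div_le_iff₀' two_pos]
  refine le_csInf hmatching ?_
  rintro _ ⟨f, hf, hfne, rfl⟩
  rw [div_le_iff₀' two_pos, ← mul_assoc, mul_one_div_cancel two_ne_zero, one_mul]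
  choose comp hcomp hunique using hpart
  have hcomp_eq : ∀ {v C}, C ∈ 𝒞 → v ∈ C → comp v = C :=
    fun hC hv => (hunique _ _ ⟨hC, hv⟩).symm
  choose γ hγ hγfix hγeven hγodd using fun S : Finset V => S.exists_involutive_fixedPoint
  have hγmem : ∀ v, γ (comp v) v ∈ comp v := by
    intro v
    by_contra h
    have h1 := hγfix _ _ h
    rw [hγ] at h1
    exact h (h1 ▸ (hcomp v).2)
  set g : V → V := fun v => γ (comp v) v with hg_def
  have hgcomp : ∀ v, comp (g v) = comp v := fun v => hcomp_eq (hcomp v).1 (hγmem v)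
  have hg : Function.Involutive g := by
    intro v
    change γ (comp (g v)) (γ (comp v) v) = v
    rw [hgcomp, hγ]
  have hfixed : ∀ C ∈ 𝒞.filter (fun C => Odd C.card), ∃ c, comp c = C ∧
      ∀ v ∈ C, g v = v ↔ v = c := by
    intro C hC
    rw [Finset.mem_filter] at hC
    obtain ⟨c, hcC, hc⟩ := hγodd C hC.2
    refine ⟨c, hcomp_eq hC.1 hcC, fun v hv => ?_⟩
    rw [← hc v hv, hg_def]
    simp only [hcomp_eq hC.1 hv]
  have hfixed_odd : ∀ v, g v = v → Odd (comp v).card := by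
    intro v hv
    by_contra h
    exact hγeven (comp v) (Nat.not_odd_iff_even.1 h) v (hcomp v).2 hv
  let P : Finset V → V → Prop := fun C v => Odd (comp v).card ∧ comp v ≠ C
  have hsegment : ∀ C ∈ 𝒞.filter (fun C => Odd C.card), ∃ c, ∃ n : ℕ, comp c = C ∧
      P C ((g ∘ f)^[n] c) ∧ ∀ k < n, ¬ P C ((g ∘ f)^[k] c) := by
    classical
    intro C hC
    obtain ⟨c, rfl, hc⟩ := hfixed C hC
    obtain ⟨k, hk, hkc⟩ :=
      hf.exists_iterate_comp_fixedPoint hfne hg ((hc c (hcomp c).2).2 rfl)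
    have hex : ∃ n, P (comp c) ((g ∘ f)^[n] c) := by
      refine ⟨k, hfixed_odd _ hk, fun h => hkc ((hc _ ?_).1 hk)⟩
      rw [← h]
      exact (hcomp _).2
    exact ⟨c, Nat.find hex, rfl, Nat.find_spec hex, fun k hk => Nat.find_min hex hk⟩
  rcases (𝒞.filter (fun C => Odd C.card)).eq_empty_or_nonempty with hempty | ⟨C₀, hC₀⟩
  · rw [hempty, Finset.sum_empty]
    exact Finset.sum_nonneg fun v _ => dist_nonneg
  have : Nonempty V := ⟨(hne C₀ (Finset.mem_filter.1 hC₀).1).choose⟩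
  choose! c n hc hn hlt using hsegment
  refine le_trans (Finset.sum_le_sum fun C hC => ?_)
    (Finset.sum_iterate_le_sum (hg.injective.comp hf.injective)
      (fun v => (dist_nonneg : 0 ≤ dist v (f v))) _ c n P hn hlt ?_)
  · have hw := comprDist_le_sum_compDist (𝒞 := 𝒞) (n C) (fun i => comp ((g ∘ f)^[i] (c C)))
      (fun i => (hcomp _).1) (fun i hi => by
        have := hlt C hC i hi
        simp only [P, not_and_or, not_not, Nat.not_odd_iff_even] at this
        simpa [hc C hC] using this)
    simp only [Function.iterate_zero, id_eq, hc C hC] at hw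
    refine le_trans (csInf_le ⟨0, ?_⟩
      ⟨comp ((g ∘ f)^[n C] (c C)), (hcomp _).1, (hn C hC).1, (hn C hC).2, rfl⟩)
      (hw.trans (Finset.sum_le_sum fun i _ => ?_))
    · rintro x ⟨C', -, -, -, rfl⟩
      exact comprDist_nonneg 𝒞 C C'
    · refine compDist_le_dist (hcomp _).2 ?_
      rw [Function.iterate_succ_apply', Function.comp_apply, hgcomp]
      exact (hcomp _).2
  · intro C hC C' hC' hne'
    refine ⟨?_, ?_⟩
    · rw [hc C' hC']
      exact (Finset.mem_filter.1 hC').2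
    · rw [hc C' hC']
      exact hne'.symm
end

section
/- Let (V, g) be a finite metric space with n = |V| ≥ 2, and let OPT_TSP be the minimum total length of a traveling salesman tour of V (a cyclic ordering of all of V, with length the sum of consecutive distances). Suppose each vertex p is assigned a real number l_p such that (i) g(p, q) ≥ min(l_p, l_q) for all distinct p, q ∈ V, and (ii) l_p ≤ (1/2) · OPT_TSP for all p ∈ V. Then ∑_{p ∈ V} l_p ≤ (1/2) · (⌈log₂ n⌉ + 1) · OPT_TSP. -/
/-- The length of the traveling salesman tour of `V` given by the cyclic ordering
`σ : Fin n ≃ V` (where `n = |V| > 0`): the sum of consecutive distances. -/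
noncomputable def tourLength {V : Type*} [Fintype V] [MetricSpace V]
    (hn : 0 < Fintype.card V) (σ : Fin (Fintype.card V) ≃ V) : ℝ :=
  ∑ i : Fin (Fintype.card V),
    dist (σ i) (σ ⟨(i.1 + 1) % Fintype.card V, Nat.mod_lt _ hn⟩)

/-- `optTSP` : the minimum length of a traveling salesman tour of the finite
metric space `V`. -/
noncomputable def optTSP (V : Type*) [Fintype V] [MetricSpace V]
    (hn : 0 < Fintype.card V) : ℝ :=
  sInf {L : ℝ | ∃ σ : Fin (Fintype.card V) ≃ V, L = tourLength hn σ}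

namespace TSP

section Lists

variable {V : Type*}

section Length

variable [MetricSpace V]

/-- The length of the path from `a` through the points of a list to `z`. -/
noncomputable def pathLength (a : V) : List V → V → ℝ
  | [], z => dist a z
  | b :: t, z => dist a b + pathLength b t z

/-- The length of the closed tour through the points of a list. -/
noncomputable def cycleLength : List V → ℝ
  | [] => 0
  | a :: t => pathLength a t a

/-- The total length of the matching pairing each even position of a list with the next one. -/
noncomputable def matchingLength : List V → ℝ
  | a :: b :: t => dist a b + matchingLength t
  | _ => 0

theorem dist_le_pathLength (a : V) (t : List V) (z : V) : dist a z ≤ pathLength a t z := by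
  induction t generalizing a with
  | nil => exact le_rfl
  | cons b t ih =>
    have h := dist_triangle a b z
    have := ih b
    simp only [pathLength]
    linarith

theorem pathLength_nonneg (a : V) (t : List V) (z : V) : 0 ≤ pathLength a t z :=
  dist_nonneg.trans (dist_le_pathLength a t z)

theorem pathLength_le_dist_add (a b : V) (t : List V) (z : V) :
    pathLength a t z ≤ dist a b + pathLength b t z := by
  cases t with
  | nil => exact dist_triangle a b z
  | cons c t =>
    have h := dist_triangle a b c
    simp only [pathLength]
    linarith

theorem pathLength_le_add_dist (a : V) (t : List V) (y z : V) :
    pathLength a t z ≤ pathLength a t y + dist y z := by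
  induction t generalizing a with
  | nil => exact dist_triangle a y z
  | cons c t ih =>
    have := ih c
    simp only [pathLength]
    linarith

theorem pathLength_append_singleton (a : V) (t : List V) (y z : V) :
    pathLength a (t ++ [y]) z = pathLength a t y + dist y z := by
  induction t generalizing a with
  | nil => rfl
  | cons c t ih => simp only [List.cons_append, pathLength, ih, add_assoc]

theorem pathLength_le_of_sublist {s t : List V} (h : s.Sublist t) (a z : V) :
    pathLength a s z ≤ pathLength a t z := by
  induction h generalizing a with
  | slnil => exact le_rfl
  | cons b _ ih => exact (ih a).trans (pathLength_le_dist_add a b _ z)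
  | cons_cons b _ ih => exact add_le_add le_rfl (ih b)

theorem cycleLength_le_of_sublist {s t : List V} (h : s.Sublist t) :
    cycleLength s ≤ cycleLength t := by
  induction h with
  | slnil => exact le_rfl
  | @cons s t a _ ih =>
    refine ih.trans ?_
    cases t with
    | nil => exact pathLength_nonneg a [] a
    | cons b t =>
      have := pathLength_le_add_dist b t a b
      simp only [cycleLength, pathLength]
      linarith
  | cons_cons a h _ => exact pathLength_le_of_sublist h a a

theorem cycleLength_append_singleton (a : V) (t : List V) :
    cycleLength (t ++ [a]) = cycleLength (a :: t) := by
  cases t with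
  | nil => rfl
  | cons b t =>
    simp only [List.cons_append, cycleLength, pathLength, pathLength_append_singleton]
    ring

theorem matchingLength_add_matchingLength_le (a : V) (t : List V) (z : V) :
    matchingLength (a :: t) + matchingLength (t ++ [z]) ≤ pathLength a t z := by
  induction t using List.twoStepInduction generalizing a with
  | nil => simp [matchingLength, pathLength]
  | singleton b => simp [matchingLength, pathLength]
  | cons_cons b c t ih _ =>
    have := ih c
    simp only [List.cons_append, matchingLength, pathLength]
    linarith

theorem pathLength_ofFn (a : V) {n : ℕ} (f : Fin n → V) (z : V) :
    pathLength a (List.ofFn f) z =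
      ∑ i : Fin (n + 1), dist ((Fin.cons a f : Fin (n + 1) → V) i)
        ((Fin.snoc f z : Fin (n + 1) → V) i) := by
  induction n generalizing a with
  | zero => simp [pathLength, Fin.snoc]
  | succ n ih =>
    obtain ⟨b, f, rfl⟩ : ∃ b g, f = Fin.cons b g := ⟨f 0, Fin.tail f, (Fin.cons_self_tail f).symm⟩
    rw [List.ofFn_cons, Fin.sum_univ_succ, pathLength, ih, ← Fin.cons_snoc_eq_snoc_cons]
    simp

theorem cycleLength_ofFn {n : ℕ} (hn : 0 < n) (f : Fin n → V) :
    cycleLength (List.ofFn f) =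
      ∑ i : Fin n, dist (f i) (f ⟨(i.1 + 1) % n, Nat.mod_lt _ hn⟩) := by
  cases n with
  | zero => exact absurd hn (lt_irrefl 0)
  | succ n =>
    rw [List.ofFn_succ, cycleLength, pathLength_ofFn]
    refine Finset.sum_congr rfl fun i _ => ?_
    congr 1
    · exact congrFun (Fin.cons_self_tail f) i
    · induction i using Fin.lastCases with
      | last => simp
      | cast i =>
        rw [Fin.snoc_castSucc]
        congr 1
        ext
        exact (Nat.mod_eq_of_lt (Nat.succ_lt_succ i.2)).symm

end Length

/-- From each pair of the matching of a list into consecutive pairs, keep a point with the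
larger value of `l`. -/
noncomputable def halve (l : V → ℝ) : List V → List V
  | a :: b :: t => (if l a ≤ l b then b else a) :: halve l t
  | L => L

theorem halve_sublist (l : V → ℝ) (L : List V) : (halve l L).Sublist L := by
  induction L using List.twoStepInduction with
  | nil => exact .refl _
  | singleton a => exact .refl _
  | cons_cons a b t ih _ =>
    rw [halve]
    split_ifs
    · exact (ih.cons_cons b).cons a
    · exact (ih.cons b).cons_cons a

theorem length_halve (l : V → ℝ) (L : List V) : (halve l L).length = (L.length + 1) / 2 := by
  induction L using List.twoStepInduction with
  | nil => simp [halve]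
  | singleton a => simp [halve]
  | cons_cons a b t ih _ =>
    simp only [halve, List.length_cons, ih]
    omega

variable [MetricSpace V] {l : V → ℝ}

theorem sum_map_le_sum_map_halve_add (h : ∀ p q : V, p ≠ q → min (l p) (l q) ≤ dist p q)
    (L : List V) (hL : L.Nodup) :
    (L.map l).sum ≤ ((halve l L).map l).sum + matchingLength L := by
  induction L using List.twoStepInduction with
  | nil => simp [halve, matchingLength]
  | singleton a => simp [halve, matchingLength]
  | cons_cons a b t ih _ =>
    have hab := h a b fun hab => by simp [hab] at hL
    have := ih hL.of_cons.of_cons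
    simp only [halve, matchingLength, List.map_cons, List.sum_cons]
    split_ifs with hl
    · rw [min_eq_left hl] at hab
      linarith
    · rw [min_eq_right (le_of_not_ge hl)] at hab
      linarith

/-- Some sublist of half the length of a rotation of `L` carries all but half of the length of
the closed tour through `L`. -/
theorem exists_halved (h : ∀ p q : V, p ≠ q → min (l p) (l q) ≤ dist p q)
    (L : List V) (hL : L.Nodup) :
    ∃ L' : List V, L'.Nodup ∧ L'.length = (L.length + 1) / 2 ∧ cycleLength L' ≤ cycleLength L ∧
      (L.map l).sum ≤ (L'.map l).sum + (1/2) * cycleLength L := by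
  cases L with
  | nil => exact ⟨[], by simp [cycleLength]⟩
  | cons a t =>
    have hM := matchingLength_add_matchingLength_le a t a
    have hperm : (t ++ [a]).Perm (a :: t) := List.perm_append_singleton a t
    have hnd : (t ++ [a]).Nodup := hperm.nodup_iff.2 hL
    rcases le_total (matchingLength (a :: t)) (matchingLength (t ++ [a])) with hle | hle
    · refine ⟨halve l (a :: t), (halve_sublist l _).nodup hL, length_halve l _,
        cycleLength_le_of_sublist (halve_sublist l _), ?_⟩
      have := sum_map_le_sum_map_halve_add h _ hL
      simp only [cycleLength]
      linarith
    · refine ⟨halve l (t ++ [a]), (halve_sublist l _).nodup hnd, ?_, ?_, ?_⟩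
      · rw [length_halve, hperm.length_eq]
      · rw [← cycleLength_append_singleton]
        exact cycleLength_le_of_sublist (halve_sublist l _)
      · have := sum_map_le_sum_map_halve_add h _ hnd
        rw [(hperm.map l).sum_eq] at this
        simp only [cycleLength]
        linarith

theorem sum_map_le_of_cycleLength_le (h : ∀ p q : V, p ≠ q → min (l p) (l q) ≤ dist p q)
    {T : ℝ} (hT : ∀ p, l p ≤ (1/2) * T) (L : List V) (hne : L ≠ []) (hL : L.Nodup)
    (hLT : cycleLength L ≤ T) :
    (L.map l).sum ≤ (1/2) * ((Nat.clog 2 L.length : ℝ) + 1) * T := by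
  induction hm : L.length using Nat.strong_induction_on generalizing L with
  | _ m ih =>
    have hpos := List.length_pos_iff.2 hne
    obtain hm1 | hm2 : m = 1 ∨ 2 ≤ m := by omega
    · obtain ⟨a, rfl⟩ := List.length_eq_one_iff.1 (hm.trans hm1)
      simpa [hm1] using hT a
    · obtain ⟨L', hnd, hlen, hcyc, hsum⟩ := exists_halved h L hL
      rw [hm] at hlen
      have hrec := ih _ (by omega) L' (List.length_pos_iff.1 (by omega)) hnd (hcyc.trans hLT) hlen
      have hclog : Nat.clog 2 m = Nat.clog 2 ((m + 1) / 2) + 1 :=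
        Nat.clog_of_two_le one_lt_two hm2
      rw [hclog]
      push_cast
      linarith

end Lists

theorem exists_optTSP_eq_tourLength (V : Type*) [Fintype V] [MetricSpace V]
    (hn : 0 < Fintype.card V) :
    ∃ σ : Fin (Fintype.card V) ≃ V, optTSP V hn = tourLength hn σ := by
  refine Set.Nonempty.csInf_mem (s := {L : ℝ | ∃ σ : Fin (Fintype.card V) ≃ V,
    L = tourLength hn σ}) ⟨_, (Fintype.equivFin V).symm, rfl⟩ ?_
  classical
  exact (Set.finite_range fun σ : Fin (Fintype.card V) ≃ V => tourLength hn σ).subset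
    fun _ ⟨σ, hσ⟩ => ⟨σ, hσ.symm⟩

end TSP

/-- Rosenkrantz–Stearns–Lewis lemma: if a finite metric space `V` with `n = |V| ≥ 2`
has numbers `l_p` with `min(l_p, l_q) ≤ g(p,q)` for all `p ≠ q` and
`l_p ≤ OPT_TSP / 2` for all `p`, then `∑ l_p ≤ (⌈log₂ n⌉ + 1)/2 · OPT_TSP`. -/
theorem sum_l_le_log_optTSP {V : Type*} [Fintype V] [MetricSpace V]
    (hn : 2 ≤ Fintype.card V) (l : V → ℝ)
    (h1 : ∀ p q : V, p ≠ q → min (l p) (l q) ≤ dist p q)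
    (h2 : ∀ p : V, l p ≤ (1/2) * optTSP V (by omega)) :
    ∑ p, l p ≤ (1/2) * ((Nat.clog 2 (Fintype.card V) : ℝ) + 1) * optTSP V (by omega) := by
  obtain ⟨σ, hσ⟩ := TSP.exists_optTSP_eq_tourLength V (by omega)
  have hcyc := TSP.cycleLength_ofFn (by omega) σ
  have hmain := TSP.sum_map_le_of_cycleLength_le h1 h2 (List.ofFn σ)
    (List.length_pos_iff.1 (by rw [List.length_ofFn]; omega))
    (List.nodup_ofFn.2 σ.injective) (hcyc.trans hσ.symm).le
  rwa [List.length_ofFn, List.map_ofFn, List.sum_ofFn, Function.comp_def, σ.sum_comp l] at hmain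
end

section
/- Let (V, g) be a finite metric space with n = |V| even, n ≥ 2. Let M be a perfect matching of V produced by the greedy algorithm: there is an enumeration of the pairs of M as (p₁, q₁), …, (p_{n/2}, q_{n/2}) such that for each i, the pair (p_i, q_i) realizes the minimum distance g(u, v) over all pairs of distinct vertices u, v not covered by the pairs (p_j, q_j) with j < i. Let w(M) = ∑_i g(p_i, q_i) and let OPT_TSP be the minimum length of a traveling salesman tour of V. Then w(M) ≤ (1/4) · (⌈log₂ n⌉ + 1) · OPT_TSP. -/
section ListTours

variable {V : Type*} [PseudoMetricSpace V]

/-- The length of the path that visits the points of a list in order. -/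
def pathLength : List V → ℝ
  | [] => 0
  | [_] => 0
  | x :: y :: t => dist x y + pathLength (y :: t)

/-- The length of the closed walk that visits the points of a list in order and then returns to
the first one. -/
def closedLength : List V → ℝ
  | [] => 0
  | x :: t => pathLength (x :: (t ++ [x]))

/-- The total length of the first, third, fifth, ... steps of the path given by a list. -/
def alternateLength : List V → ℝ
  | [] => 0
  | [_] => 0
  | x :: y :: t => dist x y + alternateLength t

lemma pathLength_le_dist_add_pathLength (a b x : V) (t : List V) :
    pathLength (a :: (t ++ [b])) ≤ dist a x + pathLength (x :: (t ++ [b])) := by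
  cases t with
  | nil => simpa [pathLength] using dist_triangle a x b
  | cons y t =>
    simp only [List.cons_append, pathLength]
    linarith [dist_triangle a x y]

lemma pathLength_mono_of_sublist {s t : List V} (h : s.Sublist t) (a b : V) :
    pathLength (a :: (s ++ [b])) ≤ pathLength (a :: (t ++ [b])) := by
  induction h generalizing a with
  | slnil => exact le_rfl
  | cons x _ ih =>
    refine (pathLength_le_dist_add_pathLength a b x _).trans ?_
    simpa [pathLength] using ih x
  | cons_cons x _ ih => simpa [pathLength] using ih x

lemma pathLength_append_pair (s : List V) (x y : V) :
    pathLength (s ++ [x, y]) = pathLength (s ++ [x]) + dist x y := by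
  induction s with
  | nil => simp [pathLength]
  | cons a s ih =>
    cases s with
    | nil => simp [pathLength]
    | cons b s =>
      simp only [List.cons_append, pathLength] at ih ⊢
      rw [ih]; ring

lemma closedLength_append_singleton (t : List V) (x : V) :
    closedLength (t ++ [x]) = closedLength (x :: t) := by
  cases t with
  | nil => rfl
  | cons y t =>
    have h := pathLength_append_pair (y :: t) x y
    simp only [List.cons_append, List.append_assoc, List.nil_append, closedLength,
      pathLength] at h ⊢
    rw [h, dist_comm]; ring

lemma closedLength_nonneg (s : List V) : 0 ≤ closedLength s := by
  have h (s : List V) : 0 ≤ pathLength s := by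
    induction s with
    | nil => exact le_rfl
    | cons x t ih =>
      cases t with
      | nil => exact le_rfl
      | cons y t => exact add_nonneg dist_nonneg ih
  cases s with
  | nil => exact le_rfl
  | cons x t => exact h _

lemma closedLength_mono_of_sublist {s t : List V} (h : s.Sublist t) :
    closedLength s ≤ closedLength t := by
  induction h with
  | slnil => exact le_rfl
  | @cons s t x _ ih =>
    refine ih.trans ?_
    rw [← closedLength_append_singleton]
    cases t with
    | nil => exact closedLength_nonneg _
    | cons y t => exact pathLength_mono_of_sublist (List.sublist_append_left t [x]) y y
  | cons_cons x h _ => exact pathLength_mono_of_sublist h x x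

lemma two_mul_dist_le_closedLength {s : List V} {u v : V} (hu : u ∈ s) (hv : v ∈ s) :
    2 * dist u v ≤ closedLength s := by
  by_cases huv : u = v
  · simpa [huv] using closedLength_nonneg s
  have hpair (x y : V) : closedLength [x, y] = dist x y + dist y x := by
    simp [closedLength, pathLength]
  obtain ⟨a, b, rfl⟩ := List.append_of_mem hu
  rcases List.mem_append.1 hv with h | h
  · have hs : [v, u].Sublist (a ++ u :: b) :=
      (List.singleton_sublist.2 h).append ((List.nil_sublist b).cons_cons u)
    have := closedLength_mono_of_sublist hs
    rw [hpair] at this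
    linarith [dist_comm u v]
  · have hb : v ∈ b := by simpa [Ne.symm huv] using h
    have hs : [u, v].Sublist (a ++ u :: b) :=
      ((List.singleton_sublist.2 hb).cons_cons u).trans (List.sublist_append_right a _)
    have := closedLength_mono_of_sublist hs
    rw [hpair] at this
    linarith [dist_comm u v]

lemma alternateLength_add_alternateLength_tail (x : V) (t : List V) :
    alternateLength (x :: t) + alternateLength t = pathLength (x :: t) := by
  induction t generalizing x with
  | nil => simp [alternateLength, pathLength]
  | cons y t ih =>
    simp only [pathLength, alternateLength, ← ih y]
    ring

lemma alternateLength_le_append_singleton (s : List V) (x : V) :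
    alternateLength s ≤ alternateLength (s ++ [x]) := by
  induction s using List.twoStepInduction with
  | nil => exact le_rfl
  | singleton y => simp [alternateLength]
  | cons_cons y z t ih _ => simpa [alternateLength] using ih

lemma alternateLength_add_rotate_le_closedLength (x : V) (t : List V) :
    alternateLength (x :: t) + alternateLength (t ++ [x]) ≤ closedLength (x :: t) := by
  have h₁ := alternateLength_add_alternateLength_tail x (t ++ [x])
  have h₂ := alternateLength_le_append_singleton (x :: t) x
  simp only [List.cons_append] at h₂
  simp only [closedLength]
  linarith

/-- From each alternate step of a path, the endpoint with the smaller label can be dropped at a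
cost of at most the length of that step. -/
lemma exists_sublist_half {l : V → ℝ} (hl : ∀ u v, u ≠ v → min (l u) (l v) ≤ dist u v)
    (s : List V) (hs : s.Nodup) :
    ∃ t : List V, t.Sublist s ∧ t.length = (s.length + 1) / 2 ∧
      (s.map l).sum ≤ (t.map l).sum + alternateLength s := by
  induction s using List.twoStepInduction with
  | nil => exact ⟨[], List.Sublist.refl _, by simp, by simp [alternateLength]⟩
  | singleton x => exact ⟨[x], List.Sublist.refl _, by simp, by simp [alternateLength]⟩
  | cons_cons x y s ih _ =>
    have hxy : x ≠ y := by rintro rfl; simp at hs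
    obtain ⟨t, hts, hlen, hsum⟩ := ih (hs.of_cons.of_cons)
    rcases min_le_iff.1 (hl x y hxy) with h | h
    · refine ⟨y :: t, (hts.cons_cons y).cons x, by simp [hlen]; omega, ?_⟩
      simp only [List.map_cons, List.sum_cons, alternateLength]
      linarith
    · refine ⟨x :: t, (hts.cons y).cons_cons x, by simp [hlen]; omega, ?_⟩
      simp only [List.map_cons, List.sum_cons, alternateLength]
      linarith

lemma exists_half_of_closedLength_le {l : V → ℝ}
    (hl : ∀ u v, u ≠ v → min (l u) (l v) ≤ dist u v) {s : List V} (hs : s.Nodup) {B : ℝ}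
    (hB : closedLength s ≤ B) :
    ∃ t : List V, t ⊆ s ∧ t.Nodup ∧ closedLength t ≤ B ∧ t.length = (s.length + 1) / 2 ∧
      (s.map l).sum ≤ (t.map l).sum + B / 2 := by
  cases s with
  | nil => exact ⟨[], by simp, by simp, hB, by simp,
      by simpa using div_nonneg hB zero_le_two⟩
  | cons x s =>
    have hperm : (s ++ [x]).Perm (x :: s) := List.perm_append_singleton x s
    have hle := alternateLength_add_rotate_le_closedLength x s
    rcases le_total (alternateLength (x :: s)) (alternateLength (s ++ [x])) with h | h
    · obtain ⟨t, hts, hlen, hsum⟩ := exists_sublist_half hl _ hs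
      exact ⟨t, hts.subset, hs.sublist hts, (closedLength_mono_of_sublist hts).trans hB, hlen,
        by linarith⟩
    · have hs' := hperm.nodup_iff.2 hs
      obtain ⟨t, hts, hlen, hsum⟩ := exists_sublist_half hl _ hs'
      refine ⟨t, fun a ha => hperm.subset (hts.subset ha), hs'.sublist hts,
        (closedLength_mono_of_sublist hts).trans ?_, by simpa using hlen, ?_⟩
      · rwa [closedLength_append_singleton]
      · rw [(hperm.map l).sum_eq] at hsum
        linarith

/-- If the distance between any two points is at least the smaller of their labels, then the
sum of the labels is at most a logarithmic multiple of the length of a closed tour. -/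
lemma sum_map_le_clog_mul {l : V → ℝ} (hl : ∀ u v, u ≠ v → min (l u) (l v) ≤ dist u v)
    {B : ℝ} (n : ℕ) (s : List V) (hn : s.length = n) (hne : s ≠ []) (hs : s.Nodup)
    (hB : closedLength s ≤ B) (hmax : ∀ v ∈ s, l v ≤ B / 2) :
    (s.map l).sum ≤ (1 / 2) * ((Nat.clog 2 n : ℝ) + 1) * B := by
  induction n using Nat.strong_induction_on generalizing s with
  | _ n ih =>
    have hpos : 0 < n := hn ▸ List.length_pos_iff.2 hne
    obtain rfl | h2 : n = 1 ∨ 2 ≤ n := by omega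
    · obtain ⟨x, rfl⟩ := List.length_eq_one_iff.1 hn
      have := hmax x (by simp)
      simp
      linarith
    · obtain ⟨t, hts, htn, htB, htlen, hsum⟩ := exists_half_of_closedLength_le hl hs hB
      rw [hn] at htlen
      have key := ih ((n + 1) / 2) (by omega) t htlen
        (List.length_pos_iff.1 (by omega)) htn htB fun v hv => hmax v (hts hv)
      rw [Nat.clog_of_two_le one_lt_two h2]
      push_cast
      linarith

lemma sum_zipWith_dist_append_singleton (x b : V) (t : List V) :
    (List.zipWith dist (x :: t) (t ++ [b])).sum = pathLength (x :: (t ++ [b])) := by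
  induction t generalizing x with
  | nil => simp [pathLength]
  | cons y t ih =>
    have := ih y
    simp only [List.cons_append, List.zipWith_cons_cons, List.sum_cons, pathLength] at this ⊢
    rw [this]

lemma closedLength_eq_sum_zipWith_rotate (s : List V) :
    closedLength s = (List.zipWith dist s (s.rotate 1)).sum := by
  cases s with
  | nil => simp [closedLength]
  | cons x t => simp [closedLength, ← sum_zipWith_dist_append_singleton]

end ListTours

lemma closedLength_ofFn_eq_tourLength {V : Type*} [Fintype V] [MetricSpace V]
    (hn : 0 < Fintype.card V) (σ : Fin (Fintype.card V) ≃ V) :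
    closedLength (List.ofFn σ) = tourLength hn σ := by
  rw [closedLength_eq_sum_zipWith_rotate, tourLength, ← List.sum_ofFn]
  congr 1
  apply List.ext_getElem
  · simp
  · intro i h₁ h₂
    simp [List.getElem_rotate]

lemma exists_optTSP_eq_tourLength {V : Type*} [Fintype V] [MetricSpace V]
    (hn : 0 < Fintype.card V) : ∃ σ, optTSP V hn = tourLength hn σ := by
  have hfin : {L : ℝ | ∃ σ : Fin (Fintype.card V) ≃ V, L = tourLength hn σ}.Finite :=
    (Set.finite_range (tourLength hn)).subset fun _ ⟨σ, h⟩ => ⟨σ, h.symm⟩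
  have hne : {L : ℝ | ∃ σ : Fin (Fintype.card V) ≃ V, L = tourLength hn σ}.Nonempty :=
    ⟨_, (Fintype.equivFin V).symm, rfl⟩
  exact hne.csInf_mem hfin


/-- The greedy perfect matching of a finite metric space `V` with `n = |V| = 2k`
even, `n ≥ 2`: the pairs `(p_i, q_i)` partition `V` and each pair realizes the
minimum distance over all pairs of distinct vertices not covered by earlier pairs.
Its weight is at most `(1/4)(⌈log₂ n⌉ + 1) · OPT_TSP`. -/
theorem greedy_matching_le_log_optTSP {V : Type*} [Fintype V] [MetricSpace V]
    (k : ℕ) (hk : 0 < k) (hcard : Fintype.card V = 2 * k)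
    (p q : Fin k → V)
    (hbij : Function.Bijective (fun x : Fin k × Bool => if x.2 then p x.1 else q x.1))
    (hgreedy : ∀ i : Fin k, ∀ u v : V, u ≠ v →
      (∀ j : Fin k, j < i → u ≠ p j ∧ u ≠ q j) →
      (∀ j : Fin k, j < i → v ≠ p j ∧ v ≠ q j) →
      dist (p i) (q i) ≤ dist u v) :
    ∑ i, dist (p i) (q i)
      ≤ (1/4) * ((Nat.clog 2 (Fintype.card V) : ℝ) + 1) * optTSP V (by omega) := by
  obtain ⟨σ, hσ⟩ := exists_optTSP_eq_tourLength (V := V) (by omega)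
  set B := optTSP V (by omega)
  let e := Equiv.ofBijective _ hbij
  let l : V → ℝ := fun v => dist (p (e.symm v).1) (q (e.symm v).1)
  have hp (i : Fin k) : p i = e (i, true) := rfl
  have hq (i : Fin k) : q i = e (i, false) := rfl
  have hfree (u : V) (i : Fin k) (h : i ≤ (e.symm u).1) :
      ∀ j : Fin k, j < i → u ≠ p j ∧ u ≠ q j := by
    refine fun j hj => ⟨?_, ?_⟩ <;> rintro rfl
    · rw [hp, e.symm_apply_apply] at h
      exact absurd hj (not_lt.2 h)
    · rw [hq, e.symm_apply_apply] at h
      exact absurd hj (not_lt.2 h)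
  have hl (u v : V) (huv : u ≠ v) : min (l u) (l v) ≤ dist u v := by
    rcases le_total (e.symm u).1 (e.symm v).1 with h | h
    · exact (min_le_left _ _).trans (hgreedy _ u v huv (hfree u _ le_rfl) (hfree v _ h))
    · exact (min_le_right _ _).trans (hgreedy _ u v huv (hfree u _ h) (hfree v _ le_rfl))
  have hB : closedLength (List.ofFn σ) = B := by
    rw [closedLength_ofFn_eq_tourLength (by omega), hσ]
  have hmem (v : V) : v ∈ List.ofFn σ := by simpa [List.mem_ofFn] using σ.surjective v
  have hmax (v : V) : l v ≤ B / 2 := by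
    have : 2 * l v ≤ closedLength (List.ofFn σ) :=
      two_mul_dist_le_closedLength (hmem _) (hmem _)
    linarith
  have hsum : ((List.ofFn σ).map l).sum = 2 * ∑ i, dist (p i) (q i) := by
    rw [List.map_ofFn, List.sum_ofFn]
    calc ∑ i, (l ∘ σ) i = ∑ v, l v := Equiv.sum_comp σ l
      _ = ∑ x, l (e x) := (Equiv.sum_comp e l).symm
      _ = 2 * ∑ i, dist (p i) (q i) := by
        simp [l, Fintype.sum_prod_type, Finset.sum_add_distrib, two_mul]
  have key := sum_map_le_clog_mul hl (Fintype.card V) (List.ofFn σ) (by simp)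
    (List.length_pos_iff.1 (by simp; omega)) (List.nodup_ofFn.2 σ.injective) hB.le
    fun v _ => hmax v
  rw [hsum] at key
  linarith
end

section
/- Let (V, d) be a finite metric space with n = |V| even, n ≥ 2, and let M be a perfect matching of V, writing M(p) for the partner of p. Suppose that for all distinct p, q ∈ V, 2 · d(p, q) ≥ min(d(p, M(p)), d(q, M(q))). Then w(M) = (1/2) ∑_{p ∈ V} d(p, M(p)) satisfies w(M) ≤ (1/2) · (⌈log₂ n⌉ + 1) · OPT_TSP, where OPT_TSP is the minimum length of a traveling salesman tour of V. -/
namespace List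

variable {V : Type*}

section Tour

variable [PseudoMetricSpace V]

/-- The length of the path from `a` to `z` that visits the points of a list in order. -/
noncomputable def pathLength (a : V) : List V → V → ℝ
  | [], z => dist a z
  | b :: t, z => dist a b + pathLength b t z

/-- The length of the closed tour that visits the points of a list in cyclic order. -/
noncomputable def cycleLength : List V → ℝ
  | [] => 0
  | a :: t => pathLength a t a

/-- The total length of the first, third, fifth, ... steps of a list of points. -/
noncomputable def alternateLength : List V → ℝ
  | [] => 0
  | [_] => 0
  | a :: b :: t => dist a b + alternateLength t

theorem pathLength_nonneg (a : V) (t : List V) (z : V) : 0 ≤ pathLength a t z := by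
  induction t generalizing a with
  | nil => exact dist_nonneg
  | cons b t ih => exact add_nonneg dist_nonneg (ih b)

theorem cycleLength_nonneg (t : List V) : 0 ≤ cycleLength t := by
  cases t with
  | nil => exact le_rfl
  | cons a t => exact pathLength_nonneg a t a

theorem pathLength_le_dist_add (a b : V) (t : List V) (z : V) :
    pathLength a t z ≤ dist a b + pathLength b t z := by
  cases t with
  | nil => exact dist_triangle a b z
  | cons c t =>
    simp only [pathLength]
    linarith [dist_triangle a b c]

theorem pathLength_le_add_dist (a : V) (t : List V) (y z : V) :
    pathLength a t z ≤ pathLength a t y + dist y z := by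
  induction t generalizing a with
  | nil => exact dist_triangle a y z
  | cons c t ih =>
    simp only [pathLength]
    linarith [ih c]

theorem pathLength_append_singleton (a : V) (t : List V) (y z : V) :
    pathLength a (t ++ [y]) z = pathLength a t y + dist y z := by
  induction t generalizing a with
  | nil => rfl
  | cons c t ih => simp only [cons_append, pathLength, ih, add_assoc]

theorem Sublist.pathLength_le {s t : List V} (h : s <+ t) (a z : V) :
    pathLength a s z ≤ pathLength a t z := by
  induction h generalizing a with
  | slnil => exact le_rfl
  | @cons s t b _ ih => exact (pathLength_le_dist_add a b s z).trans (add_le_add_right (ih b) _)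
  | cons_cons b _ ih =>
    simp only [pathLength]
    linarith [ih b]

theorem cycleLength_le_cons (a : V) (t : List V) : cycleLength t ≤ cycleLength (a :: t) := by
  cases t with
  | nil => exact cycleLength_nonneg _
  | cons b t =>
    simp only [cycleLength, pathLength]
    linarith [pathLength_le_add_dist b t a b]

theorem Sublist.cycleLength_le {s t : List V} (h : s <+ t) :
    cycleLength s ≤ cycleLength t := by
  induction h with
  | slnil => exact le_rfl
  | cons b _ ih => exact ih.trans (cycleLength_le_cons b _)
  | cons_cons b h _ => exact h.pathLength_le b b

theorem cycleLength_append_singleton (a : V) (t : List V) :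
    cycleLength (t ++ [a]) = cycleLength (a :: t) := by
  cases t with
  | nil => rfl
  | cons b t =>
    simp only [cons_append, cycleLength, pathLength, pathLength_append_singleton]
    ring

theorem two_mul_dist_le_cycleLength {t : List V} {x y : V} (hx : x ∈ t) (hy : y ∈ t) :
    2 * dist x y ≤ cycleLength t := by
  obtain ⟨s, u, rfl⟩ := append_of_mem hx
  rw [mem_append, mem_cons] at hy
  rcases hy with hy | rfl | hy
  · have h : [y, x] <+ s ++ x :: u :=
      (singleton_sublist.2 hy).append (singleton_sublist.2 mem_cons_self)
    have := h.cycleLength_le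
    rw [cycleLength, pathLength, pathLength] at this
    linarith [dist_comm x y]
  · simpa using cycleLength_nonneg _
  · have h : [x, y] <+ s ++ x :: u :=
      ((singleton_sublist.2 hy).cons_cons x).trans (sublist_append_right _ _)
    have := h.cycleLength_le
    rw [cycleLength, pathLength, pathLength] at this
    linarith [dist_comm x y]

theorem alternateLength_le_append_singleton (x : V) :
    ∀ t : List V, alternateLength t ≤ alternateLength (t ++ [x])
  | [] => le_rfl
  | [a] => by simp [alternateLength]
  | a :: b :: t => by
    simpa [alternateLength] using alternateLength_le_append_singleton x t

theorem alternateLength_cons_add (a : V) (t : List V) (x : V) :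
    alternateLength (a :: (t ++ [x])) + alternateLength (t ++ [x]) = pathLength a t x := by
  induction t generalizing a with
  | nil => simp [alternateLength, pathLength]
  | cons b t ih =>
    simp only [cons_append, alternateLength, pathLength, ← ih b]
    ring

theorem alternateLength_add_rotate_le (a : V) (t : List V) :
    alternateLength (a :: t) + alternateLength (t ++ [a]) ≤ cycleLength (a :: t) := by
  have h := alternateLength_le_append_singleton a (a :: t)
  rw [cons_append] at h
  simp only [cycleLength, ← alternateLength_cons_add a t a]
  linarith

theorem pathLength_ofFn {m : ℕ} (f : Fin (m + 1) → V) (z : V) :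
    pathLength (f 0) (ofFn fun i : Fin m => f i.succ) z
      = ∑ i : Fin m, dist (f i.castSucc) (f i.succ) + dist (f (Fin.last m)) z := by
  induction m with
  | zero => simp [pathLength]
  | succ m ih =>
    rw [ofFn_succ, pathLength, Fin.sum_univ_succ]
    exact (congrArg _ (ih fun i => f i.succ)).trans (add_assoc _ _ _).symm

theorem cycleLength_ofFn {n : ℕ} (hn : 0 < n) (f : Fin n → V) :
    cycleLength (ofFn f)
      = ∑ i : Fin n, dist (f i) (f ⟨(i.1 + 1) % n, Nat.mod_lt _ hn⟩) := by
  obtain _ | m := n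
  · exact absurd hn (lt_irrefl 0)
  rw [ofFn_succ, cycleLength, pathLength_ofFn, Fin.sum_univ_castSucc]
  congr 1
  · refine Finset.sum_congr rfl fun i _ => ?_
    congr 2
    ext
    simp [Nat.mod_eq_of_lt]
  · congr 2
    ext
    simp

end Tour

section Prune

/-- Split a list into consecutive pairs and keep from each pair the element of larger weight. -/
noncomputable def pruneByWeight (w : V → ℝ) : List V → List V
  | [] => []
  | [a] => [a]
  | a :: b :: t => (if w a ≤ w b then b else a) :: pruneByWeight w t

theorem pruneByWeight_sublist (w : V → ℝ) : ∀ t : List V, pruneByWeight w t <+ t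
  | [] => Sublist.refl _
  | [_] => Sublist.refl _
  | a :: b :: t => by
    rw [pruneByWeight]
    split_ifs
    · exact ((pruneByWeight_sublist w t).cons_cons b).cons a
    · exact ((pruneByWeight_sublist w t).cons b).cons_cons a

theorem two_mul_length_pruneByWeight_le (w : V → ℝ) :
    ∀ t : List V, 2 * (pruneByWeight w t).length ≤ t.length + 1
  | [] => by simp [pruneByWeight]
  | [_] => by simp [pruneByWeight]
  | a :: b :: t => by
    have := two_mul_length_pruneByWeight_le w t
    simp only [pruneByWeight, length_cons]
    omega

theorem sum_le_sum_pruneByWeight_add [PseudoMetricSpace V] (w : V → ℝ)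
    (hw : ∀ p q, p ≠ q → min (w p) (w q) ≤ dist p q) :
    ∀ t : List V, t.Nodup →
      (t.map w).sum ≤ ((pruneByWeight w t).map w).sum + alternateLength t
  | [], _ => by simp [pruneByWeight, alternateLength]
  | [_], _ => by simp [pruneByWeight, alternateLength]
  | a :: b :: t, h => by
    have hab : a ≠ b := fun e => by simp [e] at h
    have ih := sum_le_sum_pruneByWeight_add w hw t h.of_cons.of_cons
    have hd := hw a b hab
    simp only [pruneByWeight, alternateLength, map_cons, sum_cons]
    split_ifs with hle
    · rw [min_eq_left hle] at hd
      linarith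
    · rw [min_eq_right (le_of_not_ge hle)] at hd
      linarith

/-- One halving step: at most half of the points (rounded down) can be discarded so that the
discarded weight is at most half of the length of the tour. -/
theorem exists_sublist_sum_le [PseudoMetricSpace V] (w : V → ℝ)
    (hw : ∀ p q, p ≠ q → min (w p) (w q) ≤ dist p q) (t : List V) (ht : t.Nodup) :
    ∃ s : List V, s.Nodup ∧ 2 * s.length ≤ t.length + 1 ∧ cycleLength s ≤ cycleLength t ∧
      (t.map w).sum ≤ (s.map w).sum + cycleLength t / 2 := by
  obtain _ | ⟨a, t⟩ := t
  · exact ⟨[], nodup_nil, by simp, le_rfl, by simp [cycleLength]⟩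
  have hperm : (t ++ [a]).Perm (a :: t) := perm_append_singleton a t
  have ht' : (t ++ [a]).Nodup := hperm.nodup_iff.2 ht
  have hsum := alternateLength_add_rotate_le a t
  have h₁ := sum_le_sum_pruneByWeight_add w hw _ ht
  have h₂ := sum_le_sum_pruneByWeight_add w hw _ ht'
  rw [(hperm.map w).sum_eq] at h₂
  rcases le_total (alternateLength (a :: t)) (alternateLength (t ++ [a])) with h | h
  · have hs := pruneByWeight_sublist w (a :: t)
    exact ⟨_, hs.nodup ht, two_mul_length_pruneByWeight_le w _, hs.cycleLength_le, by linarith⟩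
  · have hs := pruneByWeight_sublist w (t ++ [a])
    refine ⟨_, hs.nodup ht', ?_, ?_, by linarith⟩
    · rw [← hperm.length_eq]
      exact two_mul_length_pruneByWeight_le w _
    · rw [← cycleLength_append_singleton]
      exact hs.cycleLength_le

theorem sum_weight_le_of_length_le_two_pow [PseudoMetricSpace V] (w : V → ℝ)
    (hw : ∀ p q, p ≠ q → min (w p) (w q) ≤ dist p q) {T : ℝ} (hT : ∀ p, w p ≤ T / 2)
    (k : ℕ) (t : List V) (ht : t.Nodup) (hk : t.length ≤ 2 ^ k) (hC : cycleLength t ≤ T) :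
    (t.map w).sum ≤ (k + 1) * (T / 2) := by
  induction k generalizing t with
  | zero =>
    match t, hk with
    | [], _ =>
      have := (cycleLength_nonneg _).trans hC
      simpa using by linarith
    | [a], _ => simpa using hT a
  | succ k ih =>
    obtain ⟨s, hs, hlen, hsC, hsum⟩ := exists_sublist_sum_le w hw t ht
    have := ih s hs (by rw [pow_succ] at hk; omega) (hsC.trans hC)
    push_cast
    linarith

end Prune

end List

theorem sum_dist_le_clog_mul_tourLength {V : Type*} [Fintype V] [MetricSpace V]
    (hn : 0 < Fintype.card V) (M : V → V)
    (hcond : ∀ p q : V, p ≠ q → min (dist p (M p)) (dist q (M q)) ≤ 2 * dist p q)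
    (σ : Fin (Fintype.card V) ≃ V) :
    ∑ v, dist v (M v) ≤ ((Nat.clog 2 (Fintype.card V) : ℝ) + 1) * tourLength hn σ := by
  have hC : (List.ofFn σ).cycleLength = tourLength hn σ := List.cycleLength_ofFn hn σ
  have hmem (p : V) : p ∈ List.ofFn σ := List.mem_ofFn.2 (σ.surjective p)
  have h := List.sum_weight_le_of_length_le_two_pow (fun p => dist p (M p) / 2)
    (T := tourLength hn σ)
    (fun p q hpq => by
      rw [min_div_div_right zero_le_two]
      linarith [hcond p q hpq])
    (fun p => by
      have := List.two_mul_dist_le_cycleLength (hmem p) (hmem (M p))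
      linarith [dist_nonneg (x := p) (y := M p)])
    (Nat.clog 2 (Fintype.card V)) (List.ofFn σ) (List.nodup_ofFn.2 σ.injective)
    (by simpa using Nat.le_pow_clog one_lt_two _) hC.le
  rw [List.map_ofFn, List.sum_ofFn] at h
  simp only [Function.comp_apply] at h
  rw [Equiv.sum_comp σ (fun p => dist p (M p) / 2), ← Finset.sum_div] at h
  linarith


/-- Let `V` be a finite metric space with `n = |V|` even, `n ≥ 2`, and let `M` be a
perfect matching of `V` (a fixed-point-free involution) such that
`2·d(p,q) ≥ min(d(p, M p), d(q, M q))` for all distinct `p, q`.  Then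
`w(M) = (1/2) ∑_p d(p, M p) ≤ (1/2)(⌈log₂ n⌉ + 1) · OPT_TSP`. -/
theorem greedy_property_matching_le_log_optTSP {V : Type*} [Fintype V] [MetricSpace V]
    (hn : 2 ≤ Fintype.card V) (hEven : Even (Fintype.card V))
    (M : V → V) (hinv : Function.Involutive M) (hfix : ∀ v, M v ≠ v)
    (hcond : ∀ p q : V, p ≠ q → min (dist p (M p)) (dist q (M q)) ≤ 2 * dist p q) :
    (1/2) * ∑ v, dist v (M v)
      ≤ (1/2) * ((Nat.clog 2 (Fintype.card V) : ℝ) + 1) * optTSP V (by omega) := by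
  obtain ⟨σ₀⟩ : Nonempty (Fin (Fintype.card V) ≃ V) := ⟨(Fintype.equivFin V).symm⟩
  have hpos : (0 : ℝ) < (Nat.clog 2 (Fintype.card V) : ℝ) + 1 := by positivity
  have h : (∑ v, dist v (M v)) / ((Nat.clog 2 (Fintype.card V) : ℝ) + 1)
      ≤ optTSP V (by omega) := by
    refine le_csInf ⟨_, σ₀, rfl⟩ ?_
    rintro _ ⟨σ, rfl⟩
    rw [div_le_iff₀' hpos]
    exact sum_dist_le_clog_mul_tourLength _ M hcond σ
  rw [div_le_iff₀' hpos] at h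
  linarith
end

section
/- Let (S, g) be a metric space, let V be a finite set of n requests in the time-augmented space S × ℝ with n even, n ≥ 2, and let d be the time-augmented distance. Let M be a perfect matching of V such that (i) for all distinct p, q ∈ V, 2 · d(p, q) ≥ min(d(p, M(p)), d(q, M(q))), and (ii) each matched pair {u, v} with t(u) ≤ t(v) is matched at time t(u) + 2 · d(u, v). Then the total online cost, namely ∑ over matched pairs {u, v} matched at time t of [g(x(u), x(v)) + (t − t(u)) + (t − t(v))], is at most (5/2) · (⌈log₂ n⌉ + 1) · OPT_TSP, where OPT_TSP is the minimum length (with respect to d) of a traveling salesman tour of V. -/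
/-- Length of the walk from `a` to `b` visiting the points of the list in order. -/
def walkLength {α : Type*} (d : α → α → ℝ) : α → List α → α → ℝ
  | a, [], b => d a b
  | a, x :: xs, b => d a x + walkLength d x xs b

/-- Total length of the edges obtained by pairing up consecutive entries of a list. -/
def pairLength {α : Type*} (d : α → α → ℝ) : List α → ℝ
  | [] => 0
  | [_] => 0
  | x :: y :: xs => d x y + pairLength d xs

/-- From each pair of consecutive entries of a list, keep the one with the larger weight. -/
noncomputable def keepLarger {α : Type*} (w : α → ℝ) : List α → List α
  | [] => []
  | [x] => [x]
  | x :: y :: xs => (if w y ≤ w x then x else y) :: keepLarger w xs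

section Tour

variable {α : Type*} {d : α → α → ℝ} {w : α → ℝ}

theorem keepLarger_sublist (xs : List α) : (keepLarger w xs).Sublist xs := by
  induction xs using keepLarger.induct with
  | case1 => simp [keepLarger]
  | case2 x => simp [keepLarger]
  | case3 x y xs ih =>
    rw [keepLarger]
    split_ifs
    · exact (ih.cons y).cons_cons x
    · exact (ih.cons_cons y).cons x

theorem length_keepLarger (xs : List α) : (keepLarger w xs).length = (xs.length + 1) / 2 := by
  induction xs using keepLarger.induct with
  | case1 => simp [keepLarger]
  | case2 x => simp [keepLarger]
  | case3 x y xs ih =>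
    simp only [keepLarger, List.length_cons, ih]
    omega

theorem sum_le_sum_keepLarger_add_pairLength
    (hw : ∀ x y, x ≠ y → min (w x) (w y) ≤ d x y) (xs : List α) (hxs : xs.Nodup) :
    (xs.map w).sum ≤ ((keepLarger w xs).map w).sum + pairLength d xs := by
  induction xs using keepLarger.induct with
  | case1 => simp [keepLarger, pairLength]
  | case2 x => simp [keepLarger, pairLength]
  | case3 x y xs ih =>
    simp only [List.nodup_cons, List.mem_cons, not_or] at hxs
    have h := ih hxs.2.2
    have hxy := hw x y hxs.1.1
    simp only [keepLarger, pairLength, List.map_cons, List.sum_cons]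
    split_ifs with hle
    · rw [min_eq_right hle] at hxy
      linarith
    · rw [min_eq_left (not_le.mp hle).le] at hxy
      linarith

theorem walkLength_concat (a y b : α) (xs : List α) :
    walkLength d a (xs ++ [y]) b = walkLength d a xs y + d y b := by
  induction xs generalizing a with
  | nil => simp [walkLength]
  | cons x xs ih => simp [walkLength, ih, add_assoc]

theorem pairLength_cons_add_pairLength_concat (a b : α) (xs : List α) :
    pairLength d (a :: (xs ++ [b])) + pairLength d (xs ++ [b]) = walkLength d a xs b := by
  induction xs generalizing a with
  | nil => simp [pairLength, walkLength]
  | cons x xs ih =>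
    have h := ih x
    simp only [List.cons_append, walkLength, pairLength] at h ⊢
    linarith

theorem pairLength_le_pairLength_concat (hd : ∀ x y, 0 ≤ d x y) (b : α) (xs : List α) :
    pairLength d xs ≤ pairLength d (xs ++ [b]) := by
  induction xs using pairLength.induct with
  | case1 => simp [pairLength]
  | case2 x => simpa [pairLength] using hd x b
  | case3 x y xs ih => simpa [pairLength] using ih

theorem walkLength_le_add_walkLength (htri : ∀ x y z, d x z ≤ d x y + d y z)
    (a x b : α) (xs : List α) : walkLength d a xs b ≤ d a x + walkLength d x xs b := by
  cases xs with
  | nil => exact htri a x b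
  | cons y ys =>
    have h := htri a x y
    simp only [walkLength]
    linarith

theorem walkLength_le_walkLength_add (htri : ∀ x y z, d x z ≤ d x y + d y z)
    (a x b : α) (xs : List α) : walkLength d a xs b ≤ walkLength d a xs x + d x b := by
  induction xs generalizing a with
  | nil => exact htri a x b
  | cons y ys ih =>
    have h := ih y
    simp only [walkLength]
    linarith

theorem walkLength_le_of_sublist (htri : ∀ x y z, d x z ≤ d x y + d y z)
    {xs ys : List α} (h : xs.Sublist ys) (a b : α) :
    walkLength d a xs b ≤ walkLength d a ys b := by
  induction h generalizing a with
  | slnil => exact le_rfl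
  | cons x _ ih =>
    exact (walkLength_le_add_walkLength htri a x b _).trans (add_le_add_right (ih x) _)
  | cons_cons x _ ih => exact add_le_add_right (ih x) _

theorem closed_walkLength_le_of_sublist (hsymm : ∀ x y, d x y = d y x)
    (htri : ∀ x y z, d x z ≤ d x y + d y z) {x y : α} {xs ys : List α}
    (h : (x :: xs).Sublist (y :: ys)) : walkLength d x xs x ≤ walkLength d y ys y := by
  cases h with
  | cons _ h =>
    have h₁ := walkLength_le_of_sublist htri h y y
    have h₂ := walkLength_le_walkLength_add htri x y x xs
    have h₃ := hsymm x y
    simp only [walkLength] at h₁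
    linarith
  | cons_cons _ h => exact walkLength_le_of_sublist htri h x x

theorem dist_le_closed_walkLength (hsymm : ∀ x y, d x y = d y x)
    (htri : ∀ x y z, d x z ≤ d x y + d y z) (hself : ∀ x, d x x = 0) {a p q : α} {xs : List α}
    (hp : p ∈ a :: xs) (hq : q ∈ a :: xs) : d p q ≤ walkLength d a xs a := by
  have key : ∀ y ∈ a :: xs, 2 * d a y ≤ walkLength d a xs a := by
    intro y hy
    have hnil := walkLength_le_of_sublist htri (List.nil_sublist xs) a a
    rcases List.mem_cons.mp hy with rfl | hy
    · simp only [walkLength] at hnil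
      linarith [hself y]
    · have h := walkLength_le_of_sublist htri (List.singleton_sublist.mpr hy) a a
      simp only [walkLength] at h
      linarith [hsymm a y]
  linarith [key p hp, key q hq, htri p a q, hsymm p a]

/-- If the weights satisfy `min (w x) (w y) ≤ d x y`, then their sum over the points of a closed
tour is at most half the length of the tour times the logarithm of the number of points, plus the
largest weight. -/
theorem sum_le_clog_mul_closed_walkLength_add (hd : ∀ x y, 0 ≤ d x y)
    (hsymm : ∀ x y, d x y = d y x) (htri : ∀ x y z, d x z ≤ d x y + d y z)
    (hw : ∀ x y, x ≠ y → min (w x) (w y) ≤ d x y) {B : ℝ} (a : α) (xs : List α)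
    (hnd : (a :: xs).Nodup) (hB : ∀ x ∈ a :: xs, w x ≤ B) :
    ((a :: xs).map w).sum
      ≤ (Nat.clog 2 (a :: xs).length : ℝ) * (walkLength d a xs a / 2) + B := by
  induction hm : (a :: xs).length using Nat.strong_induction_on generalizing a xs with
  | _ m ih =>
  cases xs with
  | nil =>
    obtain rfl : m = 1 := by simpa using hm.symm
    simpa using hB a
  | cons y ys =>
    have hlen : m = ys.length + 2 := by simpa using hm.symm
    have step : ∀ (b : α) (zs : List α), (b :: zs).Perm (a :: y :: ys) →
        walkLength d b zs b = walkLength d a (y :: ys) a →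
        pairLength d (b :: zs) ≤ walkLength d a (y :: ys) a / 2 →
        ((a :: y :: ys).map w).sum
          ≤ (Nat.clog 2 m : ℝ) * (walkLength d a (y :: ys) a / 2) + B := by
      intro b zs hperm hwalk hpair
      have hnd' := hperm.nodup_iff.mpr hnd
      have hsub : (keepLarger w (b :: zs)).Sublist (b :: zs) := keepLarger_sublist _
      have hl : (keepLarger w (b :: zs)).length = (m + 1) / 2 := by
        rw [length_keepLarger, hperm.length_eq, hm]
      have hsum := sum_le_sum_keepLarger_add_pairLength hw (b :: zs) hnd'
      rw [(hperm.map w).sum_eq] at hsum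
      have hclog : Nat.clog 2 m = Nat.clog 2 ((m + 1) / 2) + 1 :=
        Nat.clog_of_two_le one_lt_two (by omega)
      cases hk : keepLarger w (b :: zs) with
      | nil =>
        rw [hk, List.length_nil] at hl
        omega
      | cons c cs =>
        rw [hk] at hsub hl hsum
        have hrec := ih ((m + 1) / 2) (by omega) c cs (hsub.nodup hnd')
          (fun x hx => hB x (hperm.mem_iff.mp (hsub.subset hx))) hl
        have hle := closed_walkLength_le_of_sublist hsymm htri hsub
        rw [hwalk] at hle
        have hmul : (Nat.clog 2 ((m + 1) / 2) : ℝ) * (walkLength d c cs c / 2)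
            ≤ (Nat.clog 2 ((m + 1) / 2) : ℝ) * (walkLength d a (y :: ys) a / 2) := by
          gcongr
        rw [hclog]
        push_cast
        linarith
    have hpairs := pairLength_cons_add_pairLength_concat (d := d) a a (y :: ys)
    have hmono := pairLength_le_pairLength_concat hd a (a :: y :: ys)
    rw [List.cons_append] at hmono
    rcases le_total (pairLength d (a :: y :: ys)) (walkLength d a (y :: ys) a / 2) with h | h
    · exact step a (y :: ys) (List.Perm.refl _) rfl h
    · refine step y (ys ++ [a]) (List.perm_append_singleton a (y :: ys)) ?_ ?_
      · rw [walkLength_concat, walkLength, add_comm]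
      · rw [List.cons_append] at hpairs hmono
        linarith

theorem walkLength_map_range (h : ℕ → α) (m : ℕ) :
    walkLength d (h 0) ((List.range m).map fun i => h (i + 1)) (h (m + 1))
      = ∑ i ∈ Finset.range (m + 1), d (h i) (h (i + 1)) := by
  induction m with
  | zero => simp [walkLength]
  | succ m ih =>
    rw [List.range_succ, List.map_append, List.map_singleton, walkLength_concat, ih,
      Finset.sum_range_succ _ (m + 1)]

end Tour

/-- If `min (d i (f i)) (d j (f j)) ≤ 2 * d i j` for all distinct `i` and `j`, then the sum of the
distances `d i (f i)` is at most `⌈log₂ n⌉ + 1` times the length of any tour. -/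
theorem sum_le_clog_add_one_mul_tour_length {n : ℕ} (hn : 0 < n) {d : Fin n → Fin n → ℝ}
    (hd : ∀ x y, 0 ≤ d x y) (hsymm : ∀ x y, d x y = d y x)
    (htri : ∀ x y z, d x z ≤ d x y + d y z) (hself : ∀ x, d x x = 0) (f : Fin n → Fin n)
    (hcond : ∀ i j : Fin n, i ≠ j → min (d i (f i)) (d j (f j)) ≤ 2 * d i j)
    (σ : Equiv.Perm (Fin n)) :
    ∑ i, d i (f i) ≤ ((Nat.clog 2 n : ℝ) + 1) *
      ∑ i : Fin n, d (σ i) (σ ⟨(i.1 + 1) % n, Nat.mod_lt _ hn⟩) := by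
  obtain ⟨m, rfl⟩ : ∃ m, n = m + 1 := ⟨n - 1, by omega⟩
  set h : ℕ → Fin (m + 1) := fun i => σ ⟨i % (m + 1), Nat.mod_lt _ hn⟩ with hh
  have hσ : ∀ i : Fin (m + 1), h i = σ i := fun i => by
    simp [hh, Nat.mod_eq_of_lt i.isLt]
  have htour : ∑ i : Fin (m + 1), d (σ i) (σ ⟨(i.1 + 1) % (m + 1), Nat.mod_lt _ hn⟩)
      = walkLength d (h 0) ((List.range m).map fun i => h (i + 1)) (h 0) := by
    have hlast : h (m + 1) = h 0 := by simp [hh]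
    have hwalk := walkLength_map_range (d := d) h m
    rw [hlast] at hwalk
    rw [hwalk, ← Fin.sum_univ_eq_sum_range (fun i => d (h i) (h (i + 1)))]
    exact Finset.sum_congr rfl fun i _ => by rw [hσ]
  have hlist : (h 0 :: (List.range m).map fun i => h (i + 1)) = List.ofFn σ := by
    rw [List.ofFn_succ, ← hσ 0]
    congr 1
    apply List.ext_getElem
    · simp
    · intro i h₁ h₂
      have hi : i < m := by simpa using h₂
      simpa using hσ (Fin.succ ⟨i, hi⟩)
  have hmem : ∀ x, x ∈ h 0 :: (List.range m).map fun i => h (i + 1) := fun x => by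
    rw [hlist, List.mem_ofFn]
    exact σ.surjective x
  have hmain := sum_le_clog_mul_closed_walkLength_add (w := fun i => d i (f i) / 2) hd hsymm htri
    (fun x y hxy => by
      have hc := hcond x y hxy
      rw [min_div_div_right zero_le_two]
      linarith)
    (B := walkLength d (h 0) ((List.range m).map fun i => h (i + 1)) (h 0) / 2)
    (h 0) ((List.range m).map fun i => h (i + 1))
    (by
      rw [hlist]
      exact List.nodup_ofFn.mpr σ.injective)
    (fun x _ => by
      have hx := dist_le_closed_walkLength hsymm htri hself (hmem x) (hmem (f x))
      simpa using div_le_div_of_nonneg_right hx zero_le_two)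
  have hsum : ((List.ofFn σ).map fun i => d i (f i) / 2).sum = (∑ i, d i (f i)) / 2 := by
    rw [List.map_ofFn, List.sum_ofFn, Finset.sum_div]
    exact Equiv.sum_comp σ fun i => d i (f i) / 2
  rw [hlist, hsum, List.length_ofFn] at hmain
  rw [htour]
  linarith


/-- Online greedy matching cost bound in the time-augmented space.  Let `V` be a set
of `n` requests `r i = (x_i, t_i)` in `S × ℝ` (`n` even, `n ≥ 2`), `d` the
time-augmented distance `d(u,v) = g(x_u, x_v) + |t_u − t_v|`, and `M` a perfect
matching (fixed-point-free involution `f`) such that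
(i) `2·d(p,q) ≥ min(d(p, M p), d(q, M q))` for all distinct `p, q`, and
(ii) each pair `{u,v}` is matched at time `τ = min(t_u, t_v) + 2·d(u,v)`.
Then the total online cost, summing over matched pairs the quantity
`g(x_u, x_v) + (τ − t_u) + (τ − t_v)`, is at most
`(5/2)(⌈log₂ n⌉ + 1) · OPT_TSP`, where `OPT_TSP` is the minimum `d`-length of a
traveling salesman tour of `V`. -/
theorem greedy_online_cost_le_log_optTSP {S : Type*} [MetricSpace S]
    (n : ℕ) (hn : 2 ≤ n) (hEven : Even n)
    (r : Fin n → S × ℝ) (hr : Function.Injective r)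
    (f : Fin n → Fin n) (hinv : Function.Involutive f) (hfix : ∀ i, f i ≠ i)
    (d : Fin n → Fin n → ℝ)
    (hd : ∀ i j, d i j = dist (r i).1 (r j).1 + |(r i).2 - (r j).2|)
    (hcond : ∀ i j : Fin n, i ≠ j → min (d i (f i)) (d j (f j)) ≤ 2 * d i j)
    (τ : Fin n → ℝ)
    (hτ : ∀ i, τ i = min (r i).2 (r (f i)).2 + 2 * d i (f i)) :
    (1/2) * ∑ i, (dist (r i).1 (r (f i)).1 + (τ i - (r i).2) + (τ i - (r (f i)).2))
      ≤ (5/2) * ((Nat.clog 2 n : ℝ) + 1) *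
        sInf {L : ℝ | ∃ σ : Equiv.Perm (Fin n),
          L = ∑ i : Fin n, d (σ i) (σ ⟨(i.1 + 1) % n, Nat.mod_lt _ (by omega)⟩)} := by
  have hd0 : ∀ i j, 0 ≤ d i j := fun i j => by
    rw [hd]
    positivity
  have hsymm : ∀ i j, d i j = d j i := fun i j => by
    rw [hd, hd, dist_comm, abs_sub_comm]
  have htri : ∀ i j k, d i k ≤ d i j + d j k := fun i j k => by
    rw [hd, hd, hd]
    linarith [dist_triangle (r i).1 (r j).1 (r k).1, abs_sub_le (r i).2 (r j).2 (r k).2]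
  have hself : ∀ i, d i i = 0 := fun i => by simp [hd]
  have hcost : ∑ i, (dist (r i).1 (r (f i)).1 + (τ i - (r i).2) + (τ i - (r (f i)).2))
      ≤ 5 * ∑ i, d i (f i) := by
    rw [Finset.mul_sum]
    refine Finset.sum_le_sum fun i _ => ?_
    have h₁ := hd i (f i)
    have h₂ := hτ i
    have h₃ := min_le_left (r i).2 (r (f i)).2
    have h₄ := min_le_right (r i).2 (r (f i)).2
    have h₅ := abs_nonneg ((r i).2 - (r (f i)).2)
    linarith
  have hpos : (0 : ℝ) < (Nat.clog 2 n : ℝ) + 1 := by positivity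
  have hopt : (∑ i, d i (f i)) / ((Nat.clog 2 n : ℝ) + 1) ≤
      sInf {L : ℝ | ∃ σ : Equiv.Perm (Fin n),
        L = ∑ i : Fin n, d (σ i) (σ ⟨(i.1 + 1) % n, Nat.mod_lt _ (by omega)⟩)} := by
    refine le_csInf ⟨_, Equiv.refl _, rfl⟩ ?_
    rintro L ⟨σ, rfl⟩
    rw [div_le_iff₀' hpos]
    exact sum_le_clog_add_one_mul_tour_length (by omega) hd0 hsymm htri hself f hcond σ
  rw [div_le_iff₀' hpos] at hopt
  linarith
end

section
/- Let K ≥ 0 be a real number, let n ≥ 0 be an integer, and let c₀, c₁, …, c_n be real numbers with c₀ = 0 and, for each 1 ≤ i ≤ n, c_i ≤ (1 + 1/i) · (2(i + 1) · K + c_{i−1}). Then for every 0 ≤ i ≤ n, c_i ≤ 2 · (i + 1) · (i + H_i) · K, where H_i = ∑_{k=1}^{i} 1/k is the i-th harmonic number (H₀ = 0). -/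
/-- The numerical induction underlying the forest weight bound: if `K ≥ 0`,
`c₀ = 0` and `c_i ≤ (1 + 1/i)·(2(i+1)·K + c_{i−1})` for `1 ≤ i ≤ n`, then
`c_i ≤ 2(i+1)(i + H_i)·K` for all `0 ≤ i ≤ n`, where `H_i = ∑_{k=1}^{i} 1/k` is the
`i`-th harmonic number. -/
theorem forest_weight_recursion (K : ℝ) (hK : 0 ≤ K) (n : ℕ) (c : ℕ → ℝ)
    (h0 : c 0 = 0)
    (hrec : ∀ i : ℕ, 1 ≤ i → i ≤ n →
      c i ≤ (1 + 1 / (i : ℝ)) * (2 * ((i : ℝ) + 1) * K + c (i - 1))) :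
    ∀ i ≤ n, c i ≤ 2 * ((i : ℝ) + 1) *
      ((i : ℝ) + ∑ k ∈ Finset.range i, (1 : ℝ) / (k + 1)) * K := by
  intro i
  induction i with
  | zero => simp [h0]
  | succ k ih =>
    intro hk
    have hc := hrec (k + 1) (by omega) hk
    rw [Nat.add_sub_cancel] at hc
    push_cast at hc ⊢
    refine hc.trans ?_
    rw [Finset.sum_range_succ]
    have hle := ih (by omega)
    set H := ∑ j ∈ Finset.range k, (1 : ℝ) / (j + 1)
    calc (1 + 1 / ((k : ℝ) + 1)) * (2 * ((k : ℝ) + 1 + 1) * K + c k)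
        ≤ (1 + 1 / ((k : ℝ) + 1)) *
            (2 * ((k : ℝ) + 1 + 1) * K + 2 * ((k : ℝ) + 1) * (k + H) * K) := by
          gcongr
      _ = 2 * ((k : ℝ) + 1 + 1) * ((k : ℝ) + 1 + (H + 1 / ((k : ℝ) + 1))) * K := by
          field_simp
          ring
end
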